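/- arXiv:2206.09648 — 2 statements merged into one kernel-verified Lean document; each statement's English description precedes it below -/
import Mathlib

section
/- There exists an absolute constant C > 0 such that for every ε ∈ (0, 1] the following holds. Let s = (0, ε^{−1/2}), and let L be a y-monotone rectilinear polygonal path such that the topmost endpoint of L lies on the x-axis, the total length of the horizontal edges of L is at most 1, and L is contained in the vertical strip {(x, y) : −1/2 ≤ x ≤ 1/2}. Then there exists a geometric graph E comprised of the edges of L together with additional segments of total weight at most C · ε^{−1/2}, such that for every point t ∈ L there is an st-path P in E with weight ‖P‖ ≤ (1 + C·ε)·|y(s) − y(t)| ≤ (1 + C·ε)·‖s − t‖. -/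
open scoped Classical

noncomputable section

/-- The Euclidean plane. -/
abbrev Plane : Type := EuclideanSpace ℝ (Fin 2)

/-- The point `(x, y) ∈ ℝ²`. -/
def pt (x y : ℝ) : Plane := (EuclideanSpace.equiv (Fin 2) ℝ).symm ![x, y]

/-- The union of the segments of a geometric graph. -/
def segUnion (E : Finset (Plane × Plane)) : Set Plane :=
  ⋃ e ∈ E, segment ℝ e.1 e.2

/-- The total weight of a geometric graph: the sum of the Euclidean lengths of its
segments. -/
def gweight (E : Finset (Plane × Plane)) : ℝ :=
  ∑ e ∈ E, ‖e.1 - e.2‖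

/-- `HasPath E s t w` : there is a polygonal path from `s` to `t`, each of whose edges is
contained in the union of the segments of `E`, of weight at most `w`. -/
def HasPath (E : Finset (Plane × Plane)) (s t : Plane) (w : ℝ) : Prop :=
  ∃ (m : ℕ) (v : ℕ → Plane), v 0 = s ∧ v m = t ∧
    (∀ i < m, segment ℝ (v i) (v (i + 1)) ⊆ segUnion E) ∧
    ∑ i ∈ Finset.range m, ‖v (i + 1) - v i‖ ≤ w

/-- A rectilinear path: every edge is horizontal or vertical. -/
def IsRectilinear (n : ℕ) (u : ℕ → Plane) : Prop :=
  ∀ i < n, u i 0 = u (i + 1) 0 ∨ u i 1 = u (i + 1) 1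

/-- The set of points of the polygonal path with vertices `u 0, …, u n`. -/
def pathSet (n : ℕ) (u : ℕ → Plane) : Set Plane :=
  ⋃ i ∈ Finset.range n, segment ℝ (u i) (u (i + 1))

/-- The edges of the polygonal path with vertices `u 0, …, u n`, as a geometric graph. -/
def pathEdges (n : ℕ) (u : ℕ → Plane) : Finset (Plane × Plane) :=
  (Finset.range n).image fun i => (u i, u (i + 1))

/-- A `y`-monotone path: the `y`-coordinates of the vertices are monotone along the
path (nondecreasing or nonincreasing). -/
def IsYMonotone (n : ℕ) (u : ℕ → Plane) : Prop :=
  (∀ i < n, u i 1 ≤ u (i + 1) 1) ∨ (∀ i < n, u (i + 1) 1 ≤ u i 1)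

/-- The total length of the horizontal edges of a rectilinear path. -/
def hper (n : ℕ) (u : ℕ → Plane) : ℝ :=
  ∑ i ∈ Finset.range n, |u (i + 1) 0 - u i 0|

@[simp] theorem pt_zero (x y : ℝ) : pt x y 0 = x := by simp [pt]

@[simp] theorem pt_one (x y : ℝ) : pt x y 1 = y := by simp [pt]

theorem Plane.norm_eq_sqrt (p : Plane) : ‖p‖ = √((p 0) ^ 2 + (p 1) ^ 2) := by
  simp [EuclideanSpace.norm_eq, Fin.sum_univ_two]

theorem Plane.norm_le_abs_add_abs (p : Plane) : ‖p‖ ≤ |p 0| + |p 1| := by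
  rw [Plane.norm_eq_sqrt]
  refine Real.sqrt_le_iff.mpr ⟨by positivity, ?_⟩
  nlinarith [sq_abs (p 0), sq_abs (p 1), abs_nonneg (p 0), abs_nonneg (p 1)]

theorem Plane.abs_one_le_norm (p : Plane) : |p 1| ≤ ‖p‖ := by
  rw [Plane.norm_eq_sqrt]
  exact Real.abs_le_sqrt (by nlinarith [sq_nonneg (p 0)])

/-- A segment of steepness at least `l` is longer than its vertical extent by at most
its horizontal extent divided by `l`. -/
theorem norm_sub_le_of_steep {p q : Plane} {x l : ℝ} (hl : 0 < l) (hx : |p 0 - q 0| ≤ x)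
    (hy : l * x ≤ p 1 - q 1) : ‖q - p‖ ≤ p 1 - q 1 + x / l := by
  have hx0 : 0 ≤ x := (abs_nonneg _).trans hx
  have hdiv : 0 ≤ x / l := by positivity
  have hdx : l * (x / l) = x := by field_simp
  rw [Plane.norm_eq_sqrt]
  refine Real.sqrt_le_iff.mpr ⟨by nlinarith [mul_nonneg hl.le hx0], ?_⟩
  have hsq : (p 0 - q 0) ^ 2 ≤ x ^ 2 := sq_le_sq' (by linarith [abs_le.mp hx]) (abs_le.mp hx).2
  have hprod : x ^ 2 ≤ (p 1 - q 1) * (x / l) := by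
    calc x ^ 2 = l * x * (x / l) := by rw [mul_right_comm, hdx, sq]
      _ ≤ _ := by gcongr
  simp only [PiLp.sub_apply]
  nlinarith [sq_nonneg (x / l), sq_nonneg x]

theorem norm_sub_le_of_drop {p q : Plane} {x : ℝ} (hx : |p 0 - q 0| ≤ x) (hy : q 1 ≤ p 1) :
    ‖p - q‖ ≤ p 1 - q 1 + x := by
  have h := Plane.norm_le_abs_add_abs (p - q)
  simp only [PiLp.sub_apply] at h
  rw [abs_of_nonneg (sub_nonneg.mpr hy)] at h
  linarith

theorem gweight_union_le (A B : Finset (Plane × Plane)) :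
    gweight (A ∪ B) ≤ gweight A + gweight B := by
  unfold gweight
  rw [← Finset.sum_union_inter]
  exact le_add_of_nonneg_right (Finset.sum_nonneg fun _ _ => norm_nonneg _)

@[simp] theorem gweight_singleton (p q : Plane) : gweight {(p, q)} = ‖p - q‖ := by
  simp [gweight]

theorem segUnion_mono {A B : Finset (Plane × Plane)} (h : A ⊆ B) : segUnion A ⊆ segUnion B :=
  Set.biUnion_subset_biUnion_left h

theorem segment_subset_segUnion {E : Finset (Plane × Plane)} {p q : Plane} (h : (p, q) ∈ E) :
    segment ℝ p q ⊆ segUnion E :=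
  Set.subset_biUnion_of_mem (u := fun e : Plane × Plane => segment ℝ e.1 e.2) h

theorem HasPath.mono {A B : Finset (Plane × Plane)} {s t : Plane} {w w' : ℝ}
    (h : HasPath A s t w) (hAB : A ⊆ B) (hw : w ≤ w') : HasPath B s t w' := by
  obtain ⟨m, v, h0, hm, hv, hs⟩ := h
  exact ⟨m, v, h0, hm, fun i hi => (hv i hi).trans (segUnion_mono hAB), hs.trans hw⟩

theorem HasPath.of_segment {E : Finset (Plane × Plane)} {s t : Plane} {w : ℝ}
    (h : segment ℝ s t ⊆ segUnion E) (hw : ‖t - s‖ ≤ w) : HasPath E s t w :=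
  ⟨1, fun i => if i = 0 then s else t, by simp, by simp,
    fun i hi => by simpa [Nat.lt_one_iff.mp hi] using h, by simpa using hw⟩

theorem HasPath.trans {E : Finset (Plane × Plane)} {s p t : Plane} {w w' : ℝ}
    (h : HasPath E s p w) (h' : HasPath E p t w') : HasPath E s t (w + w') := by
  obtain ⟨m, v, h0, hm, hv, hs⟩ := h
  obtain ⟨m', v', h0', hm', hv', hs'⟩ := h'
  let f : ℕ → Plane := fun i => if i ≤ m then v i else v' (i - m)
  have hleft : ∀ i ≤ m, f i = v i := fun i hi => if_pos hi
  have hright : ∀ i, f (m + i) = v' i := by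
    intro i
    rcases Nat.eq_zero_or_pos i with rfl | hi
    · rw [add_zero, hleft m le_rfl, hm, h0']
    · simp [f, show ¬ m + i ≤ m by omega]
  refine ⟨m + m', f, by rw [hleft 0 (Nat.zero_le _), h0], by rw [hright, hm'], ?_, ?_⟩
  · intro i hi
    rcases lt_or_ge i m with him | him
    · rw [hleft i him.le, hleft (i + 1) him]
      exact hv i him
    · obtain ⟨j, rfl⟩ := Nat.exists_eq_add_of_le him
      rw [add_assoc, hright, hright]
      exact hv' j (by omega)
  · rw [Finset.sum_range_add]
    refine add_le_add ((Finset.sum_congr rfl fun i hi => ?_).trans_le hs)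
      ((Finset.sum_congr rfl fun i _ => ?_).trans_le hs')
    · have him := Finset.mem_range.mp hi
      rw [hleft i him.le, hleft (i + 1) him]
    · rw [add_assoc, hright, hright]

/-- `γ` is a descending parametrization over `[0, n]` of a rectilinear path contained in `E`
with horizontal variation function `W`; each unit parameter interval is an edge, which is
vertical (`W` is constant) or horizontal. -/
structure IsDescent (E : Finset (Plane × Plane)) (n : ℕ) (γ : ℝ → Plane) (W : ℝ → ℝ) : Prop where
  continuous : Continuous γ
  continuous_var : Continuous W
  antitone : Antitone fun τ => γ τ 1
  monotone_var : Monotone W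
  abs_sub_le : ∀ {τ τ' : ℝ}, τ ≤ τ' → |γ τ 0 - γ τ' 0| ≤ W τ' - W τ
  edge : ∀ k < n, (∀ τ ∈ Set.Icc (k : ℝ) (k + 1), W τ = W k) ∨
    ∀ τ ∈ Set.Icc (k : ℝ) (k + 1), γ τ 1 = γ k 1
  hasPath : ∀ {τ τ' : ℝ}, 0 ≤ τ → τ ≤ τ' → τ' ≤ n →
    HasPath E (γ τ) (γ τ') (γ τ 1 - γ τ' 1 + (W τ' - W τ))

namespace IsDescent

variable {E : Finset (Plane × Plane)} {n : ℕ} {γ : ℝ → Plane} {W : ℝ → ℝ}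

theorem abs_sub_le_of_le (P : IsDescent E n γ W) {q : Plane} {a b d : ℝ}
    (hq : |q 0 - γ a 0| ≤ d) (hab : a ≤ b) : |q 0 - γ b 0| ≤ d + (W b - W a) :=
  (_root_.abs_sub_le _ (γ a 0) _).trans (add_le_add hq (P.abs_sub_le hab))

theorem continuous_height (P : IsDescent E n γ W) : Continuous fun τ => γ τ 1 :=
  (EuclideanSpace.proj (𝕜 := ℝ) (1 : Fin 2)).continuous.comp P.continuous

/-- A single segment from a high point `q` to a point `γ b` of the path. -/
theorem exists_direct (P : IsDescent E n γ W) {l : ℝ} (hl : 0 < l) {q : Plane} {a b d : ℝ}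
    (hq : |q 0 - γ a 0| ≤ d) (hab : a ≤ b) (hH : l * (d + (W b - W a)) ≤ q 1 - γ a 1)
    (hdrop : γ a 1 - γ b 1 ≤ l * (W b - W a)) :
    ∃ Ex, gweight Ex ≤ q 1 - γ a 1 + d + (l + 1) * (W b - W a) ∧
      HasPath (E ∪ Ex) q (γ b) (q 1 - γ b 1 + (d + (W b - W a)) / l) := by
  have hanti : γ b 1 ≤ γ a 1 := P.antitone hab
  have hx := P.abs_sub_le_of_le hq hab
  have hx0 := (abs_nonneg _).trans hx
  refine ⟨{(q, γ b)}, ?_, ?_⟩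
  · rw [gweight_singleton]
    refine (norm_sub_le_of_drop hx (by nlinarith)).trans ?_
    linarith
  · exact .of_segment (segment_subset_segUnion (by simp))
      (norm_sub_le_of_steep hl hx (by linarith))

/-- From a point `q` high above `γ a`, a point `γ b` further down can be reached with small
detour by adding segments whose total weight does not depend on the height of the path. -/
theorem exists_shortcut (P : IsDescent E n γ W) {l : ℝ} (hl : 0 < l) {q : Plane} {a d : ℝ}
    (ha : 0 ≤ a) (hq : |q 0 - γ a 0| ≤ d) {k : ℕ} (hk : k ≤ n) :
    ∀ b, a ≤ b → b ≤ k → l * (d + (W b - W a)) ≤ q 1 - γ a 1 →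
    ∃ Ex, gweight Ex ≤ q 1 - γ a 1 + d + (l + 1) * (W b - W a) ∧
      HasPath (E ∪ Ex) q (γ b) (q 1 - γ b 1 + (d + (W b - W a)) / l) := by
  induction k with
  | zero =>
    intro b hab hb hH
    obtain rfl : a = b := by
      push_cast at hb
      linarith
    exact P.exists_direct hl hq le_rfl hH (by simp)
  | succ k ih =>
    intro b hab hb hH
    have ih := ih (by omega)
    push_cast at hb
    have hWab := P.monotone_var hab
    rcases le_total b k with hbk | hkb
    · exact ih b hab hbk hH
    have hkn : (k : ℝ) + 1 ≤ n := by exact_mod_cast hk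
    rcases P.edge k hk with hW | hY
    · have hWb := hW b ⟨hkb, hb⟩
      obtain ⟨c, hac, hcb, hWc, Ex, hEx, hpath⟩ : ∃ c, a ≤ c ∧ c ≤ b ∧ W c = W b ∧
          ∃ Ex, gweight Ex ≤ q 1 - γ a 1 + d + (l + 1) * (W c - W a) ∧
            HasPath (E ∪ Ex) q (γ c) (q 1 - γ c 1 + (d + (W c - W a)) / l) := by
        rcases le_total a k with hak | hka
        · exact ⟨k, hak, hkb, hWb.symm, ih k hak le_rfl (by rw [← hWb]; exact hH)⟩
        · have hWa := hW a ⟨hka, hab.trans hb⟩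
          refine ⟨a, le_rfl, hab, by rw [hWa, hWb], P.exists_direct hl hq le_rfl ?_ (by simp)⟩
          rwa [hWb, ← hWa] at hH
      rw [hWc] at hEx hpath
      refine ⟨Ex, hEx, ?_⟩
      have hL := P.hasPath (ha.trans hac) hcb (hb.trans hkn)
      refine (hpath.trans (hL.mono Finset.subset_union_left le_rfl)).mono subset_rfl ?_
      rw [hWc]
      linarith
    · have hYb := hY b ⟨hkb, hb⟩
      rcases le_total (k : ℝ) a with hka | hak
      · refine P.exists_direct hl hq hab hH ?_
        rw [hYb, hY a ⟨hka, hab.trans hb⟩, sub_self]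
        exact mul_nonneg hl.le (sub_nonneg.mpr hWab)
      rcases le_total (γ a 1 - γ b 1) (l * (W b - W a)) with hdrop | hdrop
      · exact P.exists_direct hl hq hab hH hdrop
      have hWkb := mul_le_mul_of_nonneg_left (P.monotone_var hkb) hl.le
      have hcont : Continuous fun τ => -γ τ 1 - l * W τ :=
        P.continuous_height.neg.sub (continuous_const.mul P.continuous_var)
      obtain ⟨c, ⟨hac, hck⟩, hc⟩ : -γ b 1 - l * W b ∈
          (fun τ => -γ τ 1 - l * W τ) '' Set.Icc a k := by
        refine intermediate_value_Icc hak hcont.continuousOn ⟨by linarith, ?_⟩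
        simp only [hYb]
        linarith
      have hcb := hck.trans hkb
      have hWac := P.monotone_var hac
      have hWcb := P.monotone_var hcb
      have hcb' : l * (W b - W c) = γ c 1 - γ b 1 := by
        simp only at hc
        linarith
      obtain ⟨Ex, hEx, hpath⟩ := ih c hac hck (by nlinarith)
      refine ⟨Ex ∪ {(γ c, γ b)}, (gweight_union_le _ _).trans ?_, ?_⟩
      · have := norm_sub_le_of_drop (P.abs_sub_le hcb) (P.antitone hcb)
        rw [gweight_singleton]
        linarith
      · have hseg : HasPath (E ∪ (Ex ∪ {(γ c, γ b)})) (γ c) (γ b) _ :=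
          .of_segment (segment_subset_segUnion (by simp))
            (norm_sub_le_of_steep hl (P.abs_sub_le hcb) hcb'.le)
        refine ((hpath.mono (Finset.union_subset_union_right
          Finset.subset_union_left) le_rfl).trans hseg).mono subset_rfl (le_of_eq ?_)
        ring

/-- Shallow-light tree for a piece of the path of horizontal variation at most `2 ^ j * δ`,
rooted at a point `q` at height `3 ^ j * H` above the start of the piece. -/
theorem exists_tree (P : IsDescent E n γ W) {δ H : ℝ} (hδ : 0 < δ) (hδH : δ ≤ H) (j : ℕ) :
    ∀ (a b : ℝ) (q : Plane), 0 ≤ a → a ≤ b → b ≤ n → W b - W a ≤ 2 ^ j * δ →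
    q 1 = γ a 1 + 3 ^ j * H → |q 0 - γ a 0| ≤ 2 * (2 ^ j * δ) →
    ∃ Ex, gweight Ex ≤ 15 * (3 ^ j * H) ∧ ∀ τ ∈ Set.Icc a b,
      HasPath (E ∪ Ex) q (γ τ)
        (q 1 - γ τ 1 + (38 * ((2 ^ j * δ) ^ 2 / (3 ^ j * H)) + δ)) := by
  have hH : 0 < H := hδ.trans_le hδH
  induction j with
  | zero =>
    intro a b q ha hab hb hW hq1 hq0
    simp only [pow_zero, one_mul] at hW hq1 hq0 ⊢
    have hl : 0 < H / (2 * δ) := by positivity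
    obtain ⟨Ex, hEx, hpath⟩ := P.exists_direct hl hq0 (le_refl a)
      (by rw [sub_self, add_zero, div_mul_cancel₀ _ (by positivity)]; linarith) (by simp)
    refine ⟨Ex, by linarith, fun τ hτ => ?_⟩
    refine (hpath.trans ((P.hasPath ha hτ.1 (hτ.2.trans hb)).mono
      Finset.subset_union_left le_rfl)).mono subset_rfl ?_
    have hWτ := P.monotone_var hτ.2
    have hex : (2 * δ + (W a - W a)) / (H / (2 * δ)) = 4 * (δ ^ 2 / H) := by
      field_simp
      ring
    have : 0 ≤ δ ^ 2 / H := by positivity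
    rw [hex]
    linarith
  | succ j ih =>
    intro a b q ha hab hb hW hq1 hq0
    rw [show (2 : ℝ) ^ (j + 1) * δ = 2 * (2 ^ j * δ) by ring] at hW hq0 ⊢
    rw [show (3 : ℝ) ^ (j + 1) * H = 3 * (3 ^ j * H) by ring] at hq1 ⊢
    have hw : 0 < 2 ^ j * δ := by positivity
    have hh : 0 < 3 ^ j * H := by positivity
    have hwh : 2 ^ j * δ ≤ 3 ^ j * H := by gcongr; norm_num
    generalize (2 : ℝ) ^ j * δ = w at *
    generalize (3 : ℝ) ^ j * H = h at *
    have hWab := P.monotone_var hab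
    obtain ⟨c, ⟨hac, hcb⟩, hc⟩ : (W a + W b) / 2 ∈ W '' Set.Icc a b :=
      intermediate_value_Icc hab P.continuous_var.continuousOn ⟨by linarith, by linarith⟩
    have hYac : γ c 1 ≤ γ a 1 := P.antitone hac
    set l : ℝ := 2 * h / (5 * w) with hl_def
    have hl : 0 < l := by positivity
    have hlw : l * (5 * w) = 2 * h := div_mul_cancel₀ _ (by positivity)
    have hdet : 5 * w / l = 12.5 * (w ^ 2 / h) := by
      rw [hl_def]
      field_simp
      ring
    have hlx : ∀ x, x ≤ 5 * w → l * x ≤ 2 * h := fun x hx => by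
      rw [← hlw]
      gcongr
    have hxl : ∀ x, x ≤ 5 * w → x / l ≤ 12.5 * (w ^ 2 / h) := fun x hx => by
      rw [← hdet]
      gcongr
    obtain ⟨ExL, hExL, hL⟩ := ih a c (pt (γ a 0) (γ a 1 + h)) ha hac (hcb.trans hb)
      (by linarith) (by simp) (by simpa using hw.le)
    have hsegL : HasPath (E ∪ {(q, pt (γ a 0) (γ a 1 + h))}) q (pt (γ a 0) (γ a 1 + h))
        (q 1 - (γ a 1 + h) + 12.5 * (w ^ 2 / h)) := by
      refine .of_segment (segment_subset_segUnion (by simp)) ?_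
      have := norm_sub_le_of_steep (q := pt (γ a 0) (γ a 1 + h)) hl (by simpa using hq0)
        (by rw [pt_one]; linarith [hlx (2 * (2 * w)) (by linarith)])
      rw [pt_one] at this
      linarith [hxl (2 * (2 * w)) (by linarith)]
    have hweightL : ‖q - pt (γ a 0) (γ a 1 + h)‖ ≤ 6 * h := by
      have := norm_sub_le_of_drop (q := pt (γ a 0) (γ a 1 + h)) (by simpa using hq0)
        (by rw [pt_one]; linarith)
      rw [pt_one] at this
      linarith
    obtain ⟨qR, ExC, hExC, hpathC, hqR1, hqR0⟩ : ∃ qR ExC, gweight ExC ≤ 8.4 * h ∧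
        HasPath (E ∪ ExC) q qR (q 1 - qR 1 + 12.5 * (w ^ 2 / h)) ∧
        qR 1 = γ c 1 + h ∧ |qR 0 - γ c 0| ≤ 2 * w := by
      rcases le_total (γ a 1 - γ c 1) h with hD | hD
      · have hx : |q 0 - γ c 0| ≤ 5 * w := by
          linarith [P.abs_sub_le_of_le hq0 hac]
        refine ⟨pt (γ c 0) (γ c 1 + h), {(q, pt (γ c 0) (γ c 1 + h))}, ?_, ?_, by simp,
          by simpa using hw.le⟩
        · rw [gweight_singleton]
          have := norm_sub_le_of_drop (q := pt (γ c 0) (γ c 1 + h)) (by simpa using hx)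
            (by rw [pt_one]; linarith)
          rw [pt_one] at this
          linarith
        · refine .of_segment (segment_subset_segUnion (by simp)) ?_
          rw [← hdet]
          exact norm_sub_le_of_steep hl (by simpa using hx) (by rw [pt_one]; linarith)
      · obtain ⟨e, ⟨hae, hec⟩, he⟩ : γ c 1 + h ∈ (fun τ => γ τ 1) '' Set.Icc a c :=
          intermediate_value_Icc' hac P.continuous_height.continuousOn
            ⟨by linarith, by linarith⟩
        have hWae := P.monotone_var hae
        have hWec := P.monotone_var hec
        have hx : 2 * (2 * w) + (W e - W a) ≤ 5 * w := by linarith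
        obtain ⟨Ex, hEx, hpath⟩ := P.exists_shortcut hl ha hq0 le_rfl e hae
          (hec.trans (hcb.trans hb)) (by linarith [hlx _ hx])
        refine ⟨γ e, Ex, hEx.trans ?_, hpath.mono subset_rfl (by linarith [hxl _ hx]), he, ?_⟩
        · have := mul_le_mul_of_nonneg_left (show W e - W a ≤ w by linarith) hl.le
          linarith
        · linarith [P.abs_sub_le hec]
    obtain ⟨ExR, hExR, hR⟩ := ih c b qR (ha.trans hac) hcb hb (by linarith) hqR1 hqR0
    have hdet' : (2 * w) ^ 2 / (3 * h) = 4 / 3 * (w ^ 2 / h) := by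
      field_simp
      ring
    have hdet0 : 0 ≤ w ^ 2 / h := by positivity
    refine ⟨({(q, pt (γ a 0) (γ a 1 + h))} ∪ ExL) ∪ (ExC ∪ ExR), ?_, fun τ hτ => ?_⟩
    · have h1 := gweight_union_le ({(q, pt (γ a 0) (γ a 1 + h))} ∪ ExL) (ExC ∪ ExR)
      have h2 := gweight_union_le {(q, pt (γ a 0) (γ a 1 + h))} ExL
      have h3 := gweight_union_le ExC ExR
      rw [gweight_singleton] at h2
      linarith
    · rw [hdet']
      rcases le_total τ c with hτc | hcτ
      · refine ((hsegL.mono ?_ le_rfl).trans ((hL τ ⟨hτ.1, hτc⟩).mono ?_ le_rfl)).mono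
          subset_rfl ?_
        · grind
        · grind
        · rw [pt_one]
          linarith
      · refine ((hpathC.mono ?_ le_rfl).trans ((hR τ ⟨hcτ, hτ.2⟩).mono ?_ le_rfl)).mono
          subset_rfl ?_
        · grind
        · grind
        · linarith

end IsDescent

/-- The fraction of the `i`-th unit interval traversed at time `τ`. -/
def edgeFraction (i : ℕ) (τ : ℝ) : ℝ := max 0 (min 1 (τ - i))

theorem continuous_edgeFraction (i : ℕ) : Continuous (edgeFraction i) := by
  unfold edgeFraction
  fun_prop

theorem monotone_edgeFraction (i : ℕ) : Monotone (edgeFraction i) := fun _ _ h =>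
  max_le_max le_rfl (min_le_min le_rfl (by linarith))

theorem edgeFraction_of_le {i : ℕ} {τ : ℝ} (h : τ ≤ i) : edgeFraction i τ = 0 :=
  max_eq_left ((min_le_right _ _).trans (by linarith))

theorem edgeFraction_of_ge {i : ℕ} {τ : ℝ} (h : i + 1 ≤ τ) : edgeFraction i τ = 1 := by
  rw [edgeFraction, min_eq_left (by linarith), max_eq_right zero_le_one]

theorem edgeFraction_of_mem {i : ℕ} {τ : ℝ} (h : τ ∈ Set.Icc (i : ℝ) (i + 1)) :
    edgeFraction i τ = τ - i := by
  rw [edgeFraction, min_eq_right (by linarith [h.2]), max_eq_right (by linarith [h.1])]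

theorem sum_edgeFraction_smul {M : Type*} [AddCommGroup M] [Module ℝ M] {n k : ℕ} (hk : k < n)
    {τ : ℝ} (hτ : τ ∈ Set.Icc (k : ℝ) (k + 1)) (v : ℕ → M) :
    ∑ i ∈ Finset.range n, edgeFraction i τ • v i =
      ∑ i ∈ Finset.range k, v i + (τ - k) • v k := by
  rw [← Finset.sum_subset (Finset.range_mono (Nat.succ_le_of_lt hk)), Finset.sum_range_succ,
    edgeFraction_of_mem hτ]
  · congr 1
    refine Finset.sum_congr rfl fun i hi => ?_
    have : (i : ℝ) + 1 ≤ k := by exact_mod_cast Finset.mem_range.mp hi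
    rw [edgeFraction_of_ge (this.trans hτ.1), one_smul]
  · intro i _ hi
    have : (k : ℝ) + 1 ≤ i := by exact_mod_cast not_lt.mp (mt Finset.mem_range.mpr hi)
    rw [edgeFraction_of_le (hτ.2.trans this), zero_smul]

/-- The parametrization over `[0, n]` of the polygonal path with vertices `u 0, …, u n`. -/
def pathCurve (n : ℕ) (u : ℕ → Plane) (τ : ℝ) : Plane :=
  u 0 + ∑ i ∈ Finset.range n, edgeFraction i τ • (u (i + 1) - u i)

/-- The horizontal variation of `pathCurve n u` up to time `τ`. -/
def pathVar (n : ℕ) (u : ℕ → Plane) (τ : ℝ) : ℝ :=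
  ∑ i ∈ Finset.range n, edgeFraction i τ • |u (i + 1) 0 - u i 0|

theorem pathCurve_apply (n : ℕ) (u : ℕ → Plane) (τ : ℝ) (j : Fin 2) :
    pathCurve n u τ j =
      u 0 j + ∑ i ∈ Finset.range n, edgeFraction i τ * (u (i + 1) j - u i j) := by
  simp [pathCurve]

theorem pathCurve_eq_lineMap {n k : ℕ} (hk : k < n) (u : ℕ → Plane) {τ : ℝ}
    (hτ : τ ∈ Set.Icc (k : ℝ) (k + 1)) :
    pathCurve n u τ = AffineMap.lineMap (u k) (u (k + 1)) (τ - k) := by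
  rw [pathCurve, sum_edgeFraction_smul hk hτ, Finset.sum_range_sub, AffineMap.lineMap_apply_module']
  abel

theorem pathCurve_zero (n : ℕ) (u : ℕ → Plane) : pathCurve n u 0 = u 0 := by
  simp [pathCurve, edgeFraction_of_le]

theorem pathVar_zero (n : ℕ) (u : ℕ → Plane) : pathVar n u 0 = 0 := by
  simp [pathVar, edgeFraction_of_le]

theorem pathVar_self (n : ℕ) (u : ℕ → Plane) : pathVar n u n = hper n u := by
  refine Finset.sum_congr rfl fun i hi => ?_
  rw [edgeFraction_of_ge (by exact_mod_cast Finset.mem_range.mp hi), one_smul]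

theorem exists_pathCurve_eq {n : ℕ} {u : ℕ → Plane} {t : Plane} (ht : t ∈ pathSet n u) :
    ∃ τ ∈ Set.Icc (0 : ℝ) n, pathCurve n u τ = t := by
  simp only [pathSet, Set.mem_iUnion, Finset.mem_range] at ht
  obtain ⟨k, hk, ht⟩ := ht
  rw [segment_eq_image_lineMap] at ht
  obtain ⟨r, hr, rfl⟩ := ht
  have hkn : (k : ℝ) + 1 ≤ n := by exact_mod_cast hk
  refine ⟨k + r, ⟨add_nonneg k.cast_nonneg hr.1, by linarith [hr.2]⟩, ?_⟩
  rw [pathCurve_eq_lineMap hk u ⟨by linarith [hr.1], by linarith [hr.2]⟩, add_sub_cancel_left]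

theorem isDescent_pathCurve {n : ℕ} {u : ℕ → Plane} {E : Finset (Plane × Plane)}
    (hrect : IsRectilinear n u) (hdesc : ∀ i < n, u (i + 1) 1 ≤ u i 1)
    (hE : ∀ k < n, segment ℝ (u k) (u (k + 1)) ⊆ segUnion E) :
    IsDescent E n (pathCurve n u) (pathVar n u) := by
  have hanti : Antitone fun τ => pathCurve n u τ 1 := fun τ τ' h => by
    simp only [pathCurve_apply]
    refine add_le_add le_rfl (Finset.sum_le_sum fun i hi => ?_)
    exact mul_le_mul_of_nonpos_right (monotone_edgeFraction i h)
      (sub_nonpos.mpr (hdesc i (Finset.mem_range.mp hi)))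
  have habs : ∀ {τ τ' : ℝ}, τ ≤ τ' →
      |pathCurve n u τ 0 - pathCurve n u τ' 0| ≤ pathVar n u τ' - pathVar n u τ := by
    intro τ τ' h
    rw [abs_sub_comm]
    simp only [pathCurve_apply, pathVar, add_sub_add_left_eq_sub, ← Finset.sum_sub_distrib,
      smul_eq_mul, ← sub_mul]
    refine (Finset.abs_sum_le_sum_abs _ _).trans (Finset.sum_le_sum fun i _ => ?_)
    rw [abs_mul, abs_of_nonneg (sub_nonneg.mpr (monotone_edgeFraction i h))]
  refine ⟨?_, ?_, hanti, ?_, habs, ?_, ?_⟩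
  · exact continuous_const.add (continuous_finsetSum _ fun i _ =>
      (continuous_edgeFraction i).smul continuous_const)
  · exact continuous_finsetSum _ fun i _ => (continuous_edgeFraction i).smul continuous_const
  · intro τ τ' h
    exact Finset.sum_le_sum fun i _ =>
      mul_le_mul_of_nonneg_right (monotone_edgeFraction i h) (abs_nonneg _)
  · intro k hk
    have hmem : (k : ℝ) ∈ Set.Icc (k : ℝ) (k + 1) := ⟨le_rfl, by linarith⟩
    refine (hrect k hk).imp (fun h τ hτ => ?_) (fun h τ hτ => ?_)
    · rw [pathVar, pathVar, sum_edgeFraction_smul hk hτ, sum_edgeFraction_smul hk hmem]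
      simp [h]
    · rw [pathCurve_eq_lineMap hk u hτ, pathCurve_eq_lineMap hk u hmem]
      simp [AffineMap.lineMap_apply_module', h]
  · have key : ∀ k ≤ n, ∀ τ τ' : ℝ, 0 ≤ τ → τ ≤ τ' → τ' ≤ k →
        HasPath E (pathCurve n u τ) (pathCurve n u τ')
          (pathCurve n u τ 1 - pathCurve n u τ' 1 + (pathVar n u τ' - pathVar n u τ)) := by
      intro k
      induction k with
      | zero =>
        intro _ τ τ' h0 h h'
        obtain rfl : τ = τ' := by
          push_cast at h'
          linarith
        exact ⟨0, fun _ => pathCurve n u τ, rfl, rfl, by simp, by simp⟩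
      | succ k ih =>
        intro hk τ τ' h0 h h'
        push_cast at h'
        have ih := ih (by omega)
        have hedge : ∀ a b : ℝ, k ≤ a → a ≤ b → b ≤ k + 1 →
            HasPath E (pathCurve n u a) (pathCurve n u b)
              (pathCurve n u a 1 - pathCurve n u b 1 + (pathVar n u b - pathVar n u a)) := by
          intro a b hka hab hbk
          refine .of_segment (subset_trans ?_ (hE k hk)) ?_
          · rw [pathCurve_eq_lineMap hk u ⟨hka, hab.trans hbk⟩,
              pathCurve_eq_lineMap hk u ⟨hka.trans hab, hbk⟩]
            refine (convex_segment _ _).segment_subset ?_ ?_ <;>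
            · rw [segment_eq_image_lineMap]
              exact Set.mem_image_of_mem _ ⟨by linarith, by linarith⟩
          · rw [norm_sub_rev]
            exact norm_sub_le_of_drop (habs hab) (hanti hab)
        rcases le_total τ' k with h'k | hk'
        · exact ih τ τ' h0 h h'k
        rcases le_total τ k with hτk | hkτ
        · refine ((ih τ k h0 hτk le_rfl).trans (hedge k τ' le_rfl hk' h')).mono subset_rfl ?_
          linarith
        · exact hedge τ τ' hkτ h h'
    exact fun {_ _} h0 hle hn => key n le_rfl _ _ h0 hle hn

/-- A shallow-light tree rooted at `(0, h)` for a descending rectilinear path that starts on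
the `x`-axis. -/
theorem exists_slt_of_descending {n : ℕ} {u : ℕ → Plane} {E : Finset (Plane × Plane)} {h : ℝ}
    (hh : 1 ≤ h) (hrect : IsRectilinear n u) (hdesc : ∀ i < n, u (i + 1) 1 ≤ u i 1)
    (hE : ∀ k < n, segment ℝ (u k) (u (k + 1)) ⊆ segUnion E) (htop : u 0 1 = 0)
    (hper_le : hper n u ≤ 1) (hx : |u 0 0| ≤ 2) :
    ∃ Ex, gweight Ex ≤ 15 * h ∧
      ∀ t ∈ pathSet n u, t 1 ≤ 0 ∧ HasPath (E ∪ Ex) (pt 0 h) t (h - t 1 + 40 / h) := by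
  have P := isDescent_pathCurve hrect hdesc hE
  obtain ⟨J, hJ, hJ'⟩ := exists_nat_pow_near hh one_lt_two
  have h2 : (0 : ℝ) < 2 ^ J := by positivity
  have h3 : (0 : ℝ) < 3 ^ J := by positivity
  have hh0 : 0 < h := by linarith
  have hδ : (2 : ℝ) ^ J * (2 ^ J)⁻¹ = 1 := mul_inv_cancel₀ h2.ne'
  have hH : (3 : ℝ) ^ J * (h / 3 ^ J) = h := mul_div_cancel₀ _ h3.ne'
  have hδH : ((2 : ℝ) ^ J)⁻¹ ≤ h / 3 ^ J := by
    rw [inv_eq_one_div, div_le_div_iff₀ h2 h3, one_mul]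
    calc (3 : ℝ) ^ J ≤ 4 ^ J := by gcongr; norm_num
      _ = 2 ^ J * 2 ^ J := by rw [← mul_pow]; norm_num
      _ ≤ h * 2 ^ J := by gcongr
  obtain ⟨Ex, hEx, hpath⟩ := P.exists_tree (inv_pos.mpr h2) hδH J 0 n (pt 0 h) le_rfl
    n.cast_nonneg le_rfl (by rwa [hδ, pathVar_self, pathVar_zero, sub_zero])
    (by rw [pt_one, pathCurve_zero, htop, hH, zero_add])
    (by rwa [pt_zero, pathCurve_zero, hδ, zero_sub, abs_neg, mul_one])
  rw [hδ, hH] at hpath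
  rw [hH] at hEx
  refine ⟨Ex, hEx, fun t ht => ?_⟩
  obtain ⟨τ, hτ, rfl⟩ := exists_pathCurve_eq ht
  have hτ1 : pathCurve n u τ 1 ≤ pathCurve n u 0 1 := P.antitone hτ.1
  rw [pathCurve_zero, htop] at hτ1
  refine ⟨hτ1, (hpath τ hτ).mono subset_rfl ?_⟩
  have hδ2 : ((2 : ℝ) ^ J)⁻¹ ≤ 2 / h := by
    rw [inv_eq_one_div, div_le_div_iff₀ h2 hh0, one_mul, mul_comm, ← pow_succ]
    exact hJ'.le
  rw [pt_one, one_pow, show (40 : ℝ) / h = 38 * (1 / h) + 2 / h by ring]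
  linarith

theorem pathSet_reverse (n : ℕ) (u : ℕ → Plane) :
    pathSet n (fun i => u (n - i)) = pathSet n u := by
  ext t
  simp only [pathSet, Set.mem_iUnion, Finset.mem_range, exists_prop]
  constructor
  · rintro ⟨i, hi, ht⟩
    refine ⟨n - (i + 1), by omega, ?_⟩
    rwa [show n - (i + 1) + 1 = n - i by omega, segment_symm]
  · rintro ⟨i, hi, ht⟩
    refine ⟨n - (i + 1), by omega, ?_⟩
    rwa [show n - (n - (i + 1)) = i + 1 by omega, show n - (n - (i + 1) + 1) = i by omega,
      segment_symm]

theorem hper_reverse (n : ℕ) (u : ℕ → Plane) : hper n (fun i => u (n - i)) = hper n u := by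
  unfold hper
  rw [← Finset.sum_range_reflect]
  refine Finset.sum_congr rfl fun i hi => ?_
  have hi := Finset.mem_range.mp hi
  beta_reduce
  rw [show n - (n - 1 - i + 1) = i by omega, show n - (n - 1 - i) = i + 1 by omega, abs_sub_comm]

theorem IsRectilinear.reverse {n : ℕ} {u : ℕ → Plane} (h : IsRectilinear n u) :
    IsRectilinear n fun i => u (n - i) := by
  intro i hi
  have := h (n - (i + 1)) (by omega)
  rw [show n - (i + 1) + 1 = n - i by omega] at this
  exact this.imp Eq.symm Eq.symm

theorem segment_subset_segUnion_pathEdges {n k : ℕ} (u : ℕ → Plane) (hk : k < n) :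
    segment ℝ (u k) (u (k + 1)) ⊆ segUnion (pathEdges n u) :=
  segment_subset_segUnion (Finset.mem_image_of_mem _ (Finset.mem_range.mpr hk))

/-- A shallow-light tree rooted at `(0, h)` for a `y`-monotone rectilinear path whose topmost
endpoint lies on the `x`-axis. -/
theorem exists_slt_of_isYMonotone {n : ℕ} {u : ℕ → Plane} {h : ℝ} (hh : 1 ≤ h)
    (hrect : IsRectilinear n u) (hmono : IsYMonotone n u) (htop : max (u 0 1) (u n 1) = 0)
    (hper_le : hper n u ≤ 1) (hstrip : ∀ p ∈ pathSet n u, |p 0| ≤ 2) :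
    ∃ Ex, gweight Ex ≤ 15 * h ∧
      ∀ t ∈ pathSet n u,
        t 1 ≤ 0 ∧ HasPath (pathEdges n u ∪ Ex) (pt 0 h) t (h - t 1 + 40 / h) := by
  rcases Nat.eq_zero_or_pos n with rfl | hn
  · exact ⟨∅, by simp [gweight]; linarith, by simp [pathSet]⟩
  have hmem : ∀ v : ℕ → Plane, v 0 ∈ pathSet n v := fun v =>
    Set.mem_biUnion (Finset.mem_range.mpr hn) (left_mem_segment ℝ _ _)
  rcases hmono with hmono | hmono
  · have hle : u 0 1 ≤ u n 1 := by
      have : ∀ k ≤ n, u 0 1 ≤ u k 1 := fun k => by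
        induction k with
        | zero => exact fun _ => le_rfl
        | succ k ih => exact fun hk => (ih (by omega)).trans (hmono k hk)
      exact this n le_rfl
    rw [max_eq_right hle] at htop
    rw [← pathSet_reverse] at hstrip ⊢
    refine exists_slt_of_descending hh hrect.reverse (fun i hi => ?_) (fun k hk => ?_) htop
      ((hper_reverse n u).trans_le hper_le) (hstrip _ (hmem _))
    · have := hmono (n - (i + 1)) (by omega)
      rwa [show n - (i + 1) + 1 = n - i by omega] at this
    · have := segment_subset_segUnion_pathEdges u (show n - (k + 1) < n by omega)
      rwa [show n - (k + 1) + 1 = n - k by omega, segment_symm] at this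
  · have hle : u n 1 ≤ u 0 1 := by
      have : ∀ k ≤ n, u k 1 ≤ u 0 1 := fun k => by
        induction k with
        | zero => exact fun _ => le_rfl
        | succ k ih => exact fun hk => (hmono k hk).trans (ih (by omega))
      exact this n le_rfl
    rw [max_eq_left hle] at htop
    exact exists_slt_of_descending hh hrect hmono
      (fun k hk => segment_subset_segUnion_pathEdges u hk) htop hper_le (hstrip _ (hmem u))

-- **Statement 11.** (SLT for a `y`-monotone rectilinear path.) There is an absolute
-- constant `C > 0` such that for every `ε ∈ (0,1]` and every `y`-monotone rectilinear
-- path `L` whose topmost endpoint lies on the `x`-axis, whose horizontal edges have total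
-- length at most `1`, and which lies in the vertical strip `−1/2 ≤ x ≤ 1/2`, there is a
-- geometric graph comprised of the edges of `L` and additional segments of total weight
-- at most `C·ε^{-1/2}` containing, for every `t ∈ L`, a path from `s = (0, ε^{-1/2})` to
-- `t` of weight at most `(1 + C·ε)·|y(s) − y(t)| ≤ (1 + C·ε)·‖s − t‖`.
theorem slt_ymonotone_exists :
    ∃ C : ℝ, 0 < C ∧
      ∀ ε : ℝ, 0 < ε → ε ≤ 1 →
      ∀ (n : ℕ) (u : ℕ → Plane),
        IsRectilinear n u →
        IsYMonotone n u →
        max (u 0 1) (u n 1) = 0 →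
        hper n u ≤ 1 →
        (∀ p ∈ pathSet n u, -(1/2) ≤ p 0 ∧ p 0 ≤ 1/2) →
        ∃ Ex : Finset (Plane × Plane),
          gweight Ex ≤ C * (Real.sqrt ε)⁻¹ ∧
          ∀ t ∈ pathSet n u,
            HasPath (pathEdges n u ∪ Ex) (pt 0 (Real.sqrt ε)⁻¹) t
              ((1 + C * ε) * |(Real.sqrt ε)⁻¹ - t 1|) ∧
            (1 + C * ε) * |(Real.sqrt ε)⁻¹ - t 1| ≤
              (1 + C * ε) * ‖pt 0 (Real.sqrt ε)⁻¹ - t‖ := by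
  refine ⟨40, by norm_num, fun ε hε hε1 n u hrect hmono htop hper_le hstrip => ?_⟩
  have hsqrt : 0 < √ε := Real.sqrt_pos.mpr hε
  have hh : 1 ≤ (√ε)⁻¹ := (one_le_inv₀ hsqrt).mpr (Real.sqrt_le_one.mpr hε1)
  obtain ⟨Ex, hEx, hpath⟩ := exists_slt_of_isYMonotone hh hrect hmono htop hper_le
    fun p hp => abs_le.mpr ⟨by linarith [hstrip p hp], by linarith [hstrip p hp]⟩
  refine ⟨Ex, by linarith, fun t ht => ⟨(hpath t ht).2.mono subset_rfl ?_, ?_⟩⟩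
  · have ht1 := (hpath t ht).1
    have hεh : ε * (√ε)⁻¹ = √ε := by
      rw [← div_eq_mul_inv, Real.div_sqrt]
    rw [abs_of_nonneg (by linarith), div_inv_eq_mul]
    nlinarith [mul_nonneg hε.le (neg_nonneg.mpr ht1)]
  · have := Plane.abs_one_le_norm (pt 0 (√ε)⁻¹ - t)
    rw [PiLp.sub_apply, pt_one] at this
    gcongr

end
end

section
/- Let L be a tame path, i.e. an x-monotone rectilinear polygonal path such that for every horizontal chord ab of L the subpath L_{ab} of L between a and b has length ‖L_{ab}‖ ≤ 2·‖a − b‖. Let a, b ∈ L be such that b is a bottom-most point of the subpath L_{ab} (i.e. y(b) ≤ y(c) for every point c of L_{ab}). Then ‖L_{ab}‖ ≤ 2·|x(a) − x(b)| + |y(a) − y(b)|. -/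
open scoped Classical

noncomputable section

/-- The region below an `x`-monotone path with point set `L` : points `p` that lie
vertically below some point of `L` and not below the lowest point of `L`. -/
def belowRegion (L : Set Plane) : Set Plane :=
  {p | (∃ q ∈ L, q 0 = p 0 ∧ p 1 ≤ q 1) ∧ (∃ q ∈ L, q 1 ≤ p 1)}

/-- The length of the subpath of the path `u 0, …, u n` from a point `a` on the `i`-th
edge to a point `b` on the `j`-th edge (for `i ≤ j`). -/
def subLen (u : ℕ → Plane) (i j : ℕ) (a b : Plane) : ℝ :=
  if i = j then ‖b - a‖
  else ‖u (i + 1) - a‖ + (∑ k ∈ Finset.Ico (i + 1) j, ‖u (k + 1) - u k‖) + ‖b - u j‖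

/-- The point set of the subpath of the path `u 0, …, u n` from a point `a` on the `i`-th
edge to a point `b` on the `j`-th edge (for `i ≤ j`). -/
def subSet (u : ℕ → Plane) (i j : ℕ) (a b : Plane) : Set Plane :=
  if i = j then segment ℝ a b
  else segment ℝ a (u (i + 1)) ∪
    (⋃ k ∈ Finset.Ico (i + 1) j, segment ℝ (u k) (u (k + 1))) ∪ segment ℝ (u j) b

/-- A tame path: an `x`-monotone (nondecreasing) rectilinear path such that for every
horizontal chord `ab` (with `a`, `b` on the path and the segment `ab` contained in the
region below the path), the subpath between `a` and `b` has length at most `2·‖a − b‖`. -/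
def IsTamePath (n : ℕ) (u : ℕ → Plane) : Prop :=
  IsRectilinear n u ∧ (∀ i < n, u i 0 ≤ u (i + 1) 0) ∧
  ∀ (i j : ℕ) (a b : Plane), i ≤ j → j < n →
    a ∈ segment ℝ (u i) (u (i + 1)) → b ∈ segment ℝ (u j) (u (j + 1)) →
    a 1 = b 1 → segment ℝ a b ⊆ belowRegion (pathSet n u) →
    subLen u i j a b ≤ 2 * ‖a - b‖

theorem Plane.norm_sub_le (c d : Plane) : ‖c - d‖ ≤ |c 0 - d 0| + |c 1 - d 1| := by
  rw [EuclideanSpace.norm_eq, Fin.sum_univ_two]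
  simp only [PiLp.sub_apply, Real.norm_eq_abs]
  refine Real.sqrt_le_iff.2 ⟨by positivity, ?_⟩
  nlinarith [abs_nonneg (c 0 - d 0), abs_nonneg (c 1 - d 1)]

theorem Plane.norm_sub_eq_of_snd_eq {c d : Plane} (h : c 1 = d 1) :
    ‖c - d‖ = |c 0 - d 0| := by
  rw [EuclideanSpace.norm_eq, Fin.sum_univ_two]
  simp [h, Real.sqrt_sq_eq_abs]

/-- The value of a coordinate on a segment lies between bounds valid at both endpoints. -/
theorem coord_mem_Icc_of_mem_segment {c d q : Plane} (hq : q ∈ segment ℝ c d) (t : Fin 2)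
    {l r : ℝ} (hc : c t ∈ Set.Icc l r) (hd : d t ∈ Set.Icc l r) : q t ∈ Set.Icc l r := by
  obtain ⟨s, s', hs, hs', hss, rfl⟩ := hq
  have := convex_Icc l r hc hd hs hs' hss
  simpa using this

/-- Intermediate values of a coordinate are attained on a segment. -/
theorem exists_mem_segment_coord_eq {c d : Plane} (t : Fin 2) {x : ℝ}
    (hx : x ∈ Set.Icc (c t) (d t)) : ∃ q ∈ segment ℝ c d, q t = x := by
  rw [← segment_eq_Icc (hx.1.trans hx.2)] at hx
  obtain ⟨s, s', hs, hs', hss, rfl⟩ := hx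
  exact ⟨_, ⟨s, s', hs, hs', hss, rfl⟩, by simp⟩

theorem norm_sub_add_norm_sub_of_mem_segment {c d q : Plane} (hq : q ∈ segment ℝ c d) :
    ‖q - c‖ + ‖d - q‖ = ‖d - c‖ := by
  have := dist_add_dist_of_mem_segment hq
  rw [dist_comm c q, dist_comm q d, dist_comm c d] at this
  simpa only [dist_eq_norm] using this

theorem le_snd_of_mem_segment {c d q : Plane} {h : ℝ} (hq : q ∈ segment ℝ c d)
    (hc : h ≤ c 1) (hd : h ≤ d 1) : h ≤ q 1 :=
  (coord_mem_Icc_of_mem_segment hq 1 (r := max (c 1) (d 1)) ⟨hc, le_max_left _ _⟩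
    ⟨hd, le_max_right _ _⟩).1

theorem fst_mono_of_step {n : ℕ} {u : ℕ → Plane} (hmono : ∀ i < n, u i 0 ≤ u (i + 1) 0)
    {k m : ℕ} (hkm : k ≤ m) (hm : m ≤ n) : u k 0 ≤ u m 0 := by
  induction m, hkm using Nat.le_induction with
  | base => rfl
  | succ m _ ih => exact (ih (by omega)).trans (hmono m (by omega))

theorem subLen_eq_first_edge_add {u : ℕ → Plane} {i j : ℕ} (a b : Plane) (hij : i < j) :
    subLen u i j a b = ‖u (i + 1) - a‖ + subLen u (i + 1) j (u (i + 1)) b := by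
  rcases (Nat.succ_le_of_lt hij).eq_or_lt with rfl | h
  · simp [subLen]
  · rw [subLen, subLen, if_neg hij.ne, if_neg (by omega), Finset.sum_eq_sum_Ico_succ_bot h]
    simp
    ring

theorem subLen_add_of_mem_edge {u : ℕ → Plane} {i k j : ℕ} (a b : Plane) {q : Plane}
    (hik : i < k) (hkj : k < j) (hq : q ∈ segment ℝ (u k) (u (k + 1))) :
    subLen u i k a q + subLen u k j q b = subLen u i j a b := by
  rw [subLen, subLen, subLen, if_neg hik.ne, if_neg hkj.ne, if_neg (by omega),
    ← Finset.sum_Ico_consecutive _ (Nat.succ_le_of_lt hik) hkj.le,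
    Finset.sum_eq_sum_Ico_succ_bot hkj, ← norm_sub_add_norm_sub_of_mem_segment hq]
  ring

theorem subLen_add_of_mem_last_edge {u : ℕ → Plane} {i j : ℕ} (a : Plane) {b q : Plane}
    (hij : i < j) (hq : q ∈ segment ℝ (u j) b) :
    subLen u i j a q + ‖b - q‖ = subLen u i j a b := by
  rw [subLen, subLen, if_neg hij.ne, if_neg hij.ne, ← norm_sub_add_norm_sub_of_mem_segment hq]
  ring

theorem mem_pathSet_of_mem_edge {n k : ℕ} {u : ℕ → Plane} {c d q : Plane} (hk : k < n)
    (hc : c ∈ segment ℝ (u k) (u (k + 1))) (hd : d ∈ segment ℝ (u k) (u (k + 1)))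
    (hq : q ∈ segment ℝ c d) : q ∈ pathSet n u := by
  simp only [pathSet, Set.mem_iUnion, Finset.mem_range]
  exact ⟨k, hk, (convex_segment _ _).segment_subset hc hd hq⟩

/-- If all vertices of the path after `a` up to the `k`-th one have height at least `a 1`,
then every abscissa between `a` and the `k`-th vertex is that of a path point of height at
least `a 1`. -/
theorem exists_mem_pathSet_above {n : ℕ} {u : ℕ → Plane} {i k : ℕ} {a : Plane} (hik : i < k)
    (hkn : k < n) (ha : a ∈ segment ℝ (u i) (u (i + 1)))
    (hu : ∀ m, i < m → m ≤ k → a 1 ≤ u m 1) {x : ℝ} (hx : x ∈ Set.Icc (a 0) (u k 0)) :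
    ∃ r ∈ pathSet n u, r 0 = x ∧ a 1 ≤ r 1 := by
  induction k, hik using Nat.le_induction with
  | base =>
    obtain ⟨r, hr, hrx⟩ := exists_mem_segment_coord_eq 0 hx
    exact ⟨r, mem_pathSet_of_mem_edge (by omega) ha (right_mem_segment _ _ _) hr, hrx,
      le_snd_of_mem_segment hr le_rfl (hu _ (by omega) le_rfl)⟩
  | succ k hk ih =>
    rcases le_total x (u k 0) with h | h
    · exact ih (by omega) (fun m h₁ h₂ => hu m h₁ (by omega)) ⟨hx.1, h⟩
    · obtain ⟨r, hr, hrx⟩ := exists_mem_segment_coord_eq 0 ⟨h, hx.2⟩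
      exact ⟨r, mem_pathSet_of_mem_edge (by omega) (left_mem_segment _ _ _)
        (right_mem_segment _ _ _) hr, hrx,
        le_snd_of_mem_segment hr (hu _ (by omega) (by omega)) (hu _ (by omega) le_rfl)⟩

/-- In a tame path, an excursion that starts and ends at the same height and stays above
that height has length at most twice its horizontal extent. -/
theorem IsTamePath.subLen_le_of_excursion {n : ℕ} {u : ℕ → Plane} (hL : IsTamePath n u)
    {i k : ℕ} {a q : Plane} (hik : i < k) (hkn : k < n)
    (ha : a ∈ segment ℝ (u i) (u (i + 1))) (hq : q ∈ segment ℝ (u k) (u (k + 1)))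
    (haq : a 1 = q 1) (hle : a 0 ≤ q 0) (hu : ∀ m, i < m → m ≤ k → a 1 ≤ u m 1) :
    subLen u i k a q ≤ 2 * (q 0 - a 0) := by
  have key := hL.2.2 i k a q hik.le hkn ha hq haq ?_
  · rwa [Plane.norm_sub_eq_of_snd_eq haq, abs_sub_comm, abs_of_nonneg (by linarith)] at key
  intro p hp
  have hpx := coord_mem_Icc_of_mem_segment hp 0 ⟨le_rfl, hle⟩ ⟨hle, le_rfl⟩
  have hpy := coord_mem_Icc_of_mem_segment hp 1 ⟨le_rfl, le_rfl⟩ ⟨haq.le, haq.ge⟩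
  have hpy' : p 1 = a 1 := le_antisymm hpy.2 hpy.1
  refine ⟨?_, a, mem_pathSet_of_mem_edge (by omega) ha ha (left_mem_segment _ _ _), hpy.1⟩
  rw [hpy']
  rcases le_total (p 0) (u k 0) with h | h
  · exact exists_mem_pathSet_above hik hkn ha hu ⟨hpx.1, h⟩
  · obtain ⟨r, hr, hrx⟩ := exists_mem_segment_coord_eq 0 ⟨h, hpx.2⟩
    exact ⟨r, mem_pathSet_of_mem_edge hkn (left_mem_segment _ _ _) hq hr, hrx,
      le_snd_of_mem_segment hr (hu k hik le_rfl) haq.le⟩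

/-- The length bound, with the bottom-most hypothesis stated for `a` and the vertices only. -/
theorem IsTamePath.subLen_le {n : ℕ} {u : ℕ → Plane} (hL : IsTamePath n u) {j : ℕ}
    {b : Plane} (hjn : j < n) (hb : b ∈ segment ℝ (u j) (u (j + 1))) (i : ℕ) (a : Plane)
    (hij : i ≤ j) (ha : a ∈ segment ℝ (u i) (u (i + 1))) (hba : b 1 ≤ a 1)
    (hbu : ∀ m, i < m → m ≤ j → b 1 ≤ u m 1) :
    subLen u i j a b ≤ 2 * |a 0 - b 0| + |a 1 - b 1| := by
  have hfst : ∀ {k : ℕ} {c : Plane}, k < n → c ∈ segment ℝ (u k) (u (k + 1)) →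
      u k 0 ≤ c 0 ∧ c 0 ≤ u (k + 1) 0 := fun {k c} hk hc =>
    coord_mem_Icc_of_mem_segment hc 0 ⟨le_rfl, hL.2.1 k hk⟩ ⟨hL.2.1 k hk, le_rfl⟩
  have hmono : ∀ {k m : ℕ}, k ≤ m → m ≤ n → u k 0 ≤ u m 0 := fun hkm hm =>
    fst_mono_of_step hL.2.1 hkm hm
  obtain ⟨d, hd⟩ : ∃ d, d = j - i := ⟨_, rfl⟩
  induction d using Nat.strong_induction_on generalizing i a with
  | _ d ih =>
  rcases hij.eq_or_lt with rfl | hlt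
  · have h := Plane.norm_sub_le a b
    rw [subLen, if_pos rfl, norm_sub_rev]
    linarith [abs_nonneg (a 0 - b 0)]
  have hax := hfst (hlt.trans hjn) ha
  have hbx := hfst hjn hb
  have hab : a 0 ≤ b 0 := hax.2.trans ((hmono hlt hjn.le).trans hbx.1)
  rw [abs_sub_comm, abs_of_nonneg (sub_nonneg.2 hab), abs_of_nonneg (sub_nonneg.2 hba)]
  by_cases hdown : u (i + 1) 1 ≤ a 1
  · have hx : u (i + 1) 0 ≤ b 0 := (hmono hlt hjn.le).trans hbx.1
    have hy := hbu (i + 1) (by omega) hlt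
    have h := ih (j - (i + 1)) (by omega) (i + 1) (u (i + 1)) hlt (left_mem_segment _ _ _) hy
      (fun m h₁ h₂ => hbu m (by omega) h₂) rfl
    have h' := Plane.norm_sub_le (u (i + 1)) a
    rw [abs_of_nonneg (by linarith), abs_of_nonpos (by linarith)] at h'
    rw [abs_of_nonpos (by linarith), abs_of_nonneg (by linarith)] at h
    rw [subLen_eq_first_edge_add a b hlt]
    linarith
  push Not at hdown
  by_cases hret : ∃ k, i < k ∧ k < j ∧ u (k + 1) 1 ≤ a 1
  · obtain ⟨hik, hkj, hk⟩ := Nat.find_spec hret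
    have hmin := fun m => Nat.find_min hret (m := m)
    generalize Nat.find hret = k at hik hkj hk hmin
    have hu : ∀ m, i < m → m ≤ k → a 1 ≤ u m 1 := by
      intro m h₁ h₂
      obtain ⟨m, rfl⟩ : ∃ m', m = m' + 1 := ⟨m - 1, by omega⟩
      rcases (Nat.lt_succ_iff.1 h₁).eq_or_lt with rfl | h
      · exact hdown.le
      · by_contra! hc
        exact hmin m (by omega) ⟨h, by omega, hc.le⟩
    obtain ⟨q, hq, hqa⟩ := exists_mem_segment_coord_eq 1 ⟨hk, hu k hik le_rfl⟩
    rw [segment_symm] at hq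
    have hqx := hfst (hkj.trans hjn) hq
    have haq : a 0 ≤ q 0 := hax.2.trans ((hmono hik (by omega)).trans hqx.1)
    have hqb : q 0 ≤ b 0 := hqx.2.trans ((hmono hkj (by omega)).trans hbx.1)
    have h := ih (j - k) (by omega) k q hkj.le hq (hqa ▸ hba)
      (fun m h₁ h₂ => hbu m (by omega) h₂) rfl
    rw [abs_of_nonpos (by linarith), abs_of_nonneg (by linarith)] at h
    have h' := hL.subLen_le_of_excursion hik (hkj.trans hjn) ha hq hqa.symm haq hu
    rw [← subLen_add_of_mem_edge a b hik hkj hq]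
    linarith
  · push Not at hret
    have hu : ∀ m, i < m → m ≤ j → a 1 ≤ u m 1 := by
      intro m h₁ h₂
      obtain ⟨m, rfl⟩ : ∃ m', m = m' + 1 := ⟨m - 1, by omega⟩
      rcases (Nat.lt_succ_iff.1 h₁).eq_or_lt with rfl | h
      · exact hdown.le
      · exact (hret m h (by omega)).le
    obtain ⟨q, hq, hqa⟩ := exists_mem_segment_coord_eq 1 ⟨hba, hu j hlt le_rfl⟩
    rw [segment_symm] at hq
    have hqx := coord_mem_Icc_of_mem_segment hq 0 ⟨le_rfl, hbx.1⟩ ⟨hbx.1, le_rfl⟩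
    have haq : a 0 ≤ q 0 := hax.2.trans ((hmono hlt hjn.le).trans hqx.1)
    have h := Plane.norm_sub_le b q
    rw [abs_of_nonneg (by linarith [hqx.2]), abs_of_nonpos (by linarith)] at h
    have h' := hL.subLen_le_of_excursion hlt hjn ha
      ((convex_segment _ _).segment_subset (left_mem_segment _ _ _) hb hq) hqa.symm haq hu
    rw [← subLen_add_of_mem_last_edge a hlt hq]
    linarith [hqx.2]

theorem left_mem_subSet (u : ℕ → Plane) (i j : ℕ) (a b : Plane) : a ∈ subSet u i j a b := by
  unfold subSet
  split_ifs
  · exact left_mem_segment _ _ _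
  · exact Or.inl (Or.inl (left_mem_segment _ _ _))

theorem vertex_mem_subSet {u : ℕ → Plane} {i j m : ℕ} (a b : Plane) (him : i < m)
    (hmj : m ≤ j) : u m ∈ subSet u i j a b := by
  rw [subSet, if_neg (by omega)]
  rcases hmj.eq_or_lt with rfl | h
  · exact Or.inr (left_mem_segment _ _ _)
  · refine Or.inl (Or.inr ?_)
    simp only [Set.mem_iUnion, Finset.mem_Ico]
    exact ⟨m, ⟨him, h⟩, left_mem_segment _ _ _⟩

-- **Statement 14.** Let `L` be a tame path, and let `a`, `b` be points on `L` such that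
-- `b` is a bottom-most point of the subpath `L_{ab}`. Then
-- `‖L_{ab}‖ ≤ 2·|x(a) − x(b)| + |y(a) − y(b)|`.
theorem tame_subpath_length_bound
    (n : ℕ) (u : ℕ → Plane) (hL : IsTamePath n u)
    (i j : ℕ) (a b : Plane) (hij : i ≤ j) (hjn : j < n)
    (ha : a ∈ segment ℝ (u i) (u (i + 1))) (hb : b ∈ segment ℝ (u j) (u (j + 1)))
    (hbot : ∀ c ∈ subSet u i j a b, b 1 ≤ c 1) :
    subLen u i j a b ≤ 2 * |a 0 - b 0| + |a 1 - b 1| := by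
  exact hL.subLen_le hjn hb i a hij ha (hbot a (left_mem_subSet u i j a b))
    fun m him hmj => hbot (u m) (vertex_mem_subSet a b him hmj)

end
end
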